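/- Let S_0 be an embedding of a tree with at least 17 vertices in a tree T. There exists a set X of at most 8 vertices of T such that whenever an embedding S of a tree in T is obtained from S_0 by moving three or fewer edges, every center of S is contained in X. -/

import Mathlib

open SimpleGraph Filter

/-- The degree of a vertex, as the cardinality of its neighbour set. -/
noncomputable def ndeg {V : Type*} (G : SimpleGraph V) (v : V) : ℕ :=
  (G.neighborSet v).ncard

/-- `Z_k(G)`: the number of `k`-vertex subtrees (connected subgraphs) of `G`. -/
noncomputable def subtreeCount {V : Type*} [Fintype V] (G : SimpleGraph V) (k : ℕ) : ℕ :=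
  {s : Finset V | s.card = k ∧ (G.induce (s : Set V)).Connected}.ncard

/-- The number of embeddings (subtrees isomorphic to `S`) of a tree `S` in `G`,
counted among `k`-vertex subtrees. -/
noncomputable def embCount {V W : Type*} [Fintype V] (G : SimpleGraph V)
    (S : SimpleGraph W) (k : ℕ) : ℕ :=
  {s : Finset V | s.card = k ∧ Nonempty ((G.induce (s : Set V)) ≃g S)}.ncard

/-- The density `d(S,T)`: the number of embeddings of the `|S|`-vertex tree `S` in `T`
divided by the number of `|S|`-vertex subtrees of `T` (`0` if `T` has fewer vertices). -/
noncomputable def density {V W : Type*} [Fintype V] [Fintype W]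
    (S : SimpleGraph W) (T : SimpleGraph V) : ℝ :=
  (embCount T S (Fintype.card W) : ℝ) / (subtreeCount T (Fintype.card W) : ℝ)

/-- `max { d(S,T) : T an n-vertex tree }`. -/
noncomputable def maxDensity {W : Type*} [Fintype W] (S : SimpleGraph W) (n : ℕ) : ℝ :=
  sSup {x : ℝ | ∃ T : SimpleGraph (Fin n), T.IsTree ∧ x = density S T}

/-- The inducibility of `S`: `limsup_{n → ∞} max { d(S,T) : T an n-vertex tree }`. -/
noncomputable def inducibility {W : Type*} [Fintype W] (S : SimpleGraph W) : ℝ :=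
  Filter.limsup (maxDensity S) Filter.atTop

/-- A graph is starlike if it has at most one non-leaf vertex. -/
def IsStarlike {V : Type*} (G : SimpleGraph V) : Prop :=
  {v | ndeg G v ≠ 1}.Subsingleton

/-- A graph is pathlike if its maximum degree is at most 2. -/
def IsPathlike {V : Type*} (G : SimpleGraph V) : Prop :=
  ∀ v, ndeg G v ≤ 2

/-- The vertex set of the component of `u` in `G - v`; together with the edge `uv`, this is
the branch of `G` rooted at `v` through its neighbour `u`. -/
def branchSet {V : Type*} (G : SimpleGraph V) (v u : V) : Set V :=
  {w | ∃ p : G.Walk u w, v ∉ p.support}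

/-- The branch of `G` rooted at `v` through `u` is non-trivial if it is not a single edge. -/
def NontrivialBranch {V : Type*} (G : SimpleGraph V) (v u : V) : Prop :=
  G.Adj v u ∧ branchSet G v u ≠ {u}

/-- The branch rooted at `v` through `u` is a fork: non-trivial and isomorphic to a star in
which `v` is a leaf (all vertices of the branch other than `u` and `v` are leaves of `G`). -/
def IsFork {V : Type*} (G : SimpleGraph V) (v u : V) : Prop :=
  NontrivialBranch G v u ∧ ∀ w ∈ branchSet G v u, w ≠ u → ndeg G w = 1

/-- The order of a fork: its number of leaves other than the root. -/
noncomputable def forkOrder {V : Type*} (G : SimpleGraph V) (v u : V) : ℕ :=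
  (branchSet G v u).ncard - 1

/-- A branch is major if it is non-trivial and not a fork. -/
def IsMajor {V : Type*} (G : SimpleGraph V) (v u : V) : Prop :=
  NontrivialBranch G v u ∧ ¬ IsFork G v u

/-- A caterpillar is a tree in which every vertex is the root of at most two
non-trivial branches. -/
def IsCaterpillar {V : Type*} (G : SimpleGraph V) : Prop :=
  G.IsTree ∧ ∀ v, {u | NontrivialBranch G v u}.ncard ≤ 2

/-- A center of `G`: each branch rooted at `v` has at most `|G|/2` edges (the branch through
a neighbour `u` has `(branchSet G v u).ncard` edges). -/
def IsCenter {V : Type*} [Fintype V] (G : SimpleGraph V) (v : V) : Prop :=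
  ∀ u, G.Adj v u → 2 * (branchSet G v u).ncard ≤ Fintype.card V

/-- `v` is the root of at least three non-trivial branches. -/
def RootsThreeNontrivial {V : Type*} (G : SimpleGraph V) (v : V) : Prop :=
  3 ≤ {u | NontrivialBranch G v u}.ncard

/-- A hub of `G`: a vertex `v` that is the only vertex on the path from `v` to the nearest
center of `G` that is the root of at least three non-trivial branches.  (A vertex `w` lies on
the path from `v` to `c` iff `dist v w + dist w c = dist v c`.) -/
def IsHub {V : Type*} [Fintype V] (G : SimpleGraph V) (v : V) : Prop :=
  RootsThreeNontrivial G v ∧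
  ∃ c, IsCenter G c ∧ (∀ c', IsCenter G c' → G.dist v c ≤ G.dist v c') ∧
    ∀ w, G.dist v w + G.dist w c = G.dist v c → w ≠ v → ¬ RootsThreeNontrivial G w

section BranchSet

variable {V : Type*} {G : SimpleGraph V} {v x y z a b c : V}

theorem mem_branchSet_comm : b ∈ branchSet G v a ↔ a ∈ branchSet G v b :=
  ⟨fun ⟨p, hp⟩ => ⟨p.reverse, by simpa using hp⟩, fun ⟨p, hp⟩ => ⟨p.reverse, by simpa using hp⟩⟩

theorem mem_branchSet_trans (hab : b ∈ branchSet G v a) (hbc : c ∈ branchSet G v b) :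
    c ∈ branchSet G v a := by
  obtain ⟨p, hp⟩ := hab
  obtain ⟨q, hq⟩ := hbc
  exact ⟨p.append q, by simp [SimpleGraph.Walk.mem_support_append_iff, hp, hq]⟩

theorem ne_of_mem_branchSet (h : b ∈ branchSet G v a) : b ≠ v := by
  obtain ⟨p, hp⟩ := h
  rintro rfl
  exact hp p.end_mem_support

theorem mem_branchSet_of_adj (h : G.Adj a b) (ha : a ≠ v) (hb : b ≠ v) :
    b ∈ branchSet G v a :=
  ⟨h.toWalk, by simp [ha.symm, hb.symm]⟩

/-- If `v` separates `a` from `b`, then it lies on every geodesic between them. -/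
theorem dist_add_dist_of_notMem_branchSet (hG : G.Connected) (h : b ∉ branchSet G v a) :
    G.dist a v + G.dist v b = G.dist a b := by
  classical
  obtain ⟨p, hp⟩ := hG.exists_walk_length_eq_dist a b
  have hv : v ∈ p.support := by
    by_contra hv
    exact h ⟨p, hv⟩
  have hlen := congrArg SimpleGraph.Walk.length (p.take_spec hv)
  rw [SimpleGraph.Walk.length_append] at hlen
  have h1 := SimpleGraph.dist_le (p.takeUntil v hv)
  have h2 := SimpleGraph.dist_le (p.dropUntil v hv)
  have h3 : G.dist a b ≤ G.dist a v + G.dist v b := hG.dist_triangle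
  omega

theorem exists_adj_mem_branchSet (hG : G.Connected) (h : x ≠ y) :
    ∃ u, G.Adj x u ∧ y ∈ branchSet G x u := by
  obtain ⟨p, hp⟩ := (hG.preconnected x y).exists_isPath
  cases p with
  | nil => exact absurd rfl h
  | cons hadj q =>
    rw [SimpleGraph.Walk.cons_isPath_iff] at hp
    exact ⟨_, hadj, q, hp.2⟩

theorem branchSet_induce_subset {s : Set V} {v a b : s} (h : b ∈ branchSet (G.induce s) v a) :
    (b : V) ∈ branchSet G v a := by
  obtain ⟨p, hp⟩ := h
  refine ⟨p.map (SimpleGraph.Embedding.induce s).toHom, ?_⟩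
  intro hv
  erw [SimpleGraph.Walk.support_map, List.mem_map] at hv
  obtain ⟨c, hc, hcv⟩ := hv
  exact hp (Subtype.ext hcv ▸ hc)

theorem SimpleGraph.IsAcyclic.mem_branchSet_induce (hG : G.IsAcyclic) {s : Set V}
    (hs : (G.induce s).Connected) {v a b : s} (h : (b : V) ∈ branchSet G v a) :
    b ∈ branchSet (G.induce s) v a := by
  classical
  obtain ⟨p, hp⟩ := h
  obtain ⟨q, hq⟩ := (hs.preconnected a b).exists_isPath
  refine ⟨q, fun hv => hp ?_⟩
  have hq' : (q.map (SimpleGraph.Embedding.induce s).toHom).IsPath :=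
    hq.map Subtype.val_injective
  have heq : q.map (SimpleGraph.Embedding.induce s).toHom = p.bypass :=
    congrArg Subtype.val ((hG.subsingleton_path _ _).elim ⟨_, hq'⟩ ⟨_, p.bypass_isPath⟩)
  apply p.support_bypass_subset_support
  erw [← heq, SimpleGraph.Walk.support_map, List.mem_map]
  exact ⟨v, hv, rfl⟩

theorem SimpleGraph.IsAcyclic.notMem_branchSet_of_adj (hG : G.IsAcyclic) (h : G.Adj x y)
    (hz : z ∈ branchSet G x y) : z ∉ branchSet G y x := by
  classical
  obtain ⟨p, hp⟩ := hz
  rintro ⟨q, hq⟩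
  have hp' : (SimpleGraph.Walk.cons h p.bypass).IsPath :=
    p.bypass_isPath.cons fun hx => hp (p.support_bypass_subset_support hx)
  have heq : SimpleGraph.Walk.cons h p.bypass = q.bypass :=
    congrArg Subtype.val ((hG.subsingleton_path _ _).elim ⟨_, hp'⟩ ⟨_, q.bypass_isPath⟩)
  apply hq
  apply q.support_bypass_subset_support
  rw [← heq]
  simp

end BranchSet

section Shadow

variable {V : Type*} {T : SimpleGraph V} {s : Finset V} {x y z : V}

open Classical in
/-- The vertices of `s` that `x` separates from `y`. -/
noncomputable def shadow (T : SimpleGraph V) (s : Finset V) (x y : V) : Finset V :=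
  {z ∈ s | z ∉ branchSet T x y}

theorem mem_shadow : z ∈ shadow T s x y ↔ z ∈ s ∧ z ∉ branchSet T x y := by
  simp [shadow]

theorem shadow_subset : shadow T s x y ⊆ s := fun _ h => (mem_shadow.1 h).1

theorem shadow_congr (h : z ∈ branchSet T x y) : shadow T s x y = shadow T s x z := by
  ext p
  rw [mem_shadow, mem_shadow]
  exact and_congr_right fun _ => not_congr
    ⟨mem_branchSet_trans (mem_branchSet_comm.1 h), mem_branchSet_trans h⟩

theorem disjoint_shadow (hT : T.Connected) (h : x ≠ y) :
    Disjoint (shadow T s x y) (shadow T s y x) := by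
  rw [Finset.disjoint_left]
  intro p hp hq
  have h1 := dist_add_dist_of_notMem_branchSet hT (mem_shadow.1 hp).2
  have h2 := dist_add_dist_of_notMem_branchSet hT (mem_shadow.1 hq).2
  have h3 := hT.pos_dist_of_ne h
  rw [T.dist_comm (u := y) (v := x)] at h1
  omega

/-- Three vertices none of which separates the other two have pairwise disjoint shadows that
miss some vertex of the subtree. -/
theorem card_shadow_add_lt (hT : T.IsTree) (hs : (T.induce (s : Set V)).Connected)
    (hx : x ∈ s) (hy : y ∈ s) (hxy : x ≠ y) (hyz : y ≠ z) (hxz : x ≠ z)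
    (hzxy : z ∈ branchSet T x y) (hzyx : z ∈ branchSet T y x) (hyzx : y ∈ branchSet T z x) :
    (shadow T s x y).card + (shadow T s y z).card + (shadow T s z x).card < s.card := by
  classical
  have ex := shadow_congr (s := s) hzxy
  have ey := shadow_congr (s := s) hzyx
  have ez := shadow_congr (s := s) hyzx
  have d1 : Disjoint (shadow T s x y) (shadow T s y z) :=
    ey ▸ disjoint_shadow hT.connected hxy
  have d2 : Disjoint (shadow T s x y) (shadow T s z x) :=
    ex ▸ disjoint_shadow hT.connected hxz
  have d3 : Disjoint (shadow T s y z) (shadow T s z x) :=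
    ez ▸ disjoint_shadow hT.connected hyz
  rw [← Finset.card_union_of_disjoint d1,
    ← Finset.card_union_of_disjoint (Finset.disjoint_union_left.2 ⟨d2, d3⟩)]
  obtain ⟨u, hu, huy⟩ := exists_adj_mem_branchSet hs
    (x := ⟨x, Finset.mem_coe.2 hx⟩) (y := ⟨y, Finset.mem_coe.2 hy⟩)
    fun h => hxy (congrArg Subtype.val h)
  have hxu : T.Adj x u := hu
  have hyu : y ∈ branchSet T x u := branchSet_induce_subset huy
  have hzu : z ∈ branchSet T x u := mem_branchSet_trans hyu hzxy
  have hne_y : (u : V) ≠ y := by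
    rintro rfl
    exact hT.isAcyclic.notMem_branchSet_of_adj hxu hzu hzyx
  have hne_z : (u : V) ≠ z := by
    rintro rfl
    exact hT.isAcyclic.notMem_branchSet_of_adj hxu hyu hyzx
  refine Finset.card_lt_card ⟨Finset.union_subset (Finset.union_subset shadow_subset shadow_subset)
    shadow_subset, fun hsub => ?_⟩
  have hmem := hsub u.2
  rw [← ey, Finset.mem_union, Finset.mem_union, mem_shadow, mem_shadow, mem_shadow] at hmem
  rcases hmem with (h | h) | h
  · exact h.2 (mem_branchSet_comm.1 hyu)
  · exact h.2 (mem_branchSet_of_adj hxu hxy hne_y)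
  · exact h.2 (mem_branchSet_of_adj hxu hxz hne_z)

/-- In an `n`-vertex subtree, at most `k + 2` vertices have all their shadows of size at least
`(n - k) / 2`, provided that `n` is large compared with `k`. -/
theorem card_le_of_le_card_shadow (hT : T.IsTree) (hs : (T.induce (s : Set V)).Connected)
    {k : ℕ} (hk : 3 * k < s.card + 2) (X : Finset V) (hX : X ⊆ s)
    (h : ∀ x ∈ X, ∀ y ∈ X, x ≠ y → s.card ≤ 2 * (shadow T s x y).card + k) :
    X.card ≤ k + 2 := by
  classical
  rcases Nat.lt_or_ge 1 X.card with hX1 | hX1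
  swap
  · omega
  obtain ⟨a, ha, b, hb, hab⟩ := Finset.one_lt_card.1 hX1
  obtain ⟨⟨x, y⟩, hmem, hmax⟩ := Finset.exists_max_image (X ×ˢ X) (fun p => T.dist p.1 p.2)
    ⟨(a, b), by simp [ha, hb]⟩
  rw [Finset.mem_product] at hmem
  obtain ⟨hx, hy⟩ : x ∈ X ∧ y ∈ X := hmem
  have hmax' : ∀ p ∈ X, ∀ q ∈ X, T.dist p q ≤ T.dist x y := fun p hp q hq =>
    hmax (p, q) (Finset.mk_mem_product hp hq)
  have hpos : 0 < T.dist x y :=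
    (hT.connected.pos_dist_of_ne hab).trans_le (hmax' a ha b hb)
  have hxy : x ≠ y := by
    rintro rfl
    simp at hpos
  have hbetween : ∀ z ∈ X, z ≠ x → z ≠ y → y ∉ branchSet T z x := by
    intro z hz hzx hzy hyzx
    have hzxy : z ∈ branchSet T x y := by
      by_contra hcon
      have h1 := dist_add_dist_of_notMem_branchSet hT.connected hcon
      have h2 := hmax' y hy z hz
      have h3 := hT.connected.pos_dist_of_ne hzx.symm
      rw [T.dist_comm (u := y) (v := x)] at h1
      omega
    have hzyx : z ∈ branchSet T y x := by
      by_contra hcon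
      have h1 := dist_add_dist_of_notMem_branchSet hT.connected hcon
      have h2 := hmax' x hx z hz
      have h3 := hT.connected.pos_dist_of_ne hzy.symm
      omega
    have hlt := card_shadow_add_lt hT hs (hX hx) (hX hy) hxy hzy.symm hzx.symm hzxy hzyx hyzx
    have h1 := h x hx y hy hxy
    have h2 := h y hy z hz hzy.symm
    have h3 := h z hz x hx hzx
    omega
  have hd1 := disjoint_shadow (s := s) hT.connected hxy
  have hd2 : Disjoint (shadow T s x y ∪ shadow T s y x) ((X.erase x).erase y) := by
    rw [Finset.disjoint_right]
    intro z hz hzs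
    simp only [Finset.mem_erase] at hz
    have h0 := dist_add_dist_of_notMem_branchSet hT.connected (hbetween z hz.2.2 hz.2.1 hz.1)
    have hzx := hT.connected.pos_dist_of_ne hz.2.1
    have hzy := hT.connected.pos_dist_of_ne hz.1
    rw [T.dist_comm (u := z) (v := x)] at hzx
    rw [Finset.mem_union, mem_shadow, mem_shadow] at hzs
    rcases hzs with hzs | hzs
    · have h1 := dist_add_dist_of_notMem_branchSet hT.connected hzs.2
      rw [T.dist_comm (u := y) (v := x), T.dist_comm (u := y) (v := z)] at h1
      omega
    · have h1 := dist_add_dist_of_notMem_branchSet hT.connected hzs.2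
      rw [T.dist_comm (u := y) (v := z)] at h1
      omega
  have hle : ((shadow T s x y ∪ shadow T s y x) ∪ (X.erase x).erase y).card ≤ s.card :=
    Finset.card_le_card (Finset.union_subset (Finset.union_subset shadow_subset shadow_subset)
      (((Finset.erase_subset _ _).trans (Finset.erase_subset _ _)).trans hX))
  rw [Finset.card_union_of_disjoint hd2, Finset.card_union_of_disjoint hd1,
    Finset.card_erase_of_mem (Finset.mem_erase.2 ⟨hxy.symm, hy⟩),
    Finset.card_erase_of_mem hx] at hle
  have h1 := h x hx y hy hxy
  have h2 := h y hy x hx hxy.symm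
  omega

end Shadow

theorem IsCenter.two_mul_card_le {V : Type*} [Fintype V] {T : SimpleGraph V} (hT : T.IsTree)
    {s : Finset V} (hs : (T.induce (s : Set V)).Connected) {w y : V} (hw : w ∈ s) (hy : y ∈ s)
    (hyw : y ≠ w) (hc : IsCenter (T.induce (s : Set V)) ⟨w, Finset.mem_coe.mpr hw⟩)
    {A : Finset V} (hA : A ⊆ s) (hAy : ∀ z ∈ A, z ∈ branchSet T w y) :
    2 * A.card ≤ s.card := by
  obtain ⟨u, hu, huy⟩ := exists_adj_mem_branchSet hs
    (x := ⟨w, Finset.mem_coe.2 hw⟩) (y := ⟨y, Finset.mem_coe.2 hy⟩)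
    fun h => hyw (congrArg Subtype.val h).symm
  have hcard := hc u hu
  have hsub : (A : Set V) ⊆ Subtype.val '' branchSet (T.induce (s : Set V)) ⟨w, hw⟩ u := by
    intro z hz
    exact ⟨⟨z, Finset.mem_coe.2 (hA hz)⟩, mem_branchSet_trans huy
      (hT.isAcyclic.mem_branchSet_induce hs (hAy z hz)), rfl⟩
  have hle := Set.ncard_le_ncard hsub (Set.toFinite _)
  rw [Set.ncard_image_of_injective _ Subtype.val_injective, Set.ncard_coe_finset] at hle
  have hn : Fintype.card (s : Set V) = s.card := by simp
  omega

/-- Let s0 be (the vertex set of) an embedding of a tree with at least 17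
vertices in a tree T.  There is a set X of at most 8 vertices of T such that whenever an
embedding s of a tree in T is obtained from s0 by moving three or fewer edges (i.e. the
intersection is a subtree on at least |s0| - 3 vertices), every center of the embedding s
lies in X. -/
theorem centers_after_moving_edges {V : Type*} [Fintype V] [DecidableEq V]
    (T : SimpleGraph V) (hT : T.IsTree)
    (s0 : Finset V) (hs0 : (T.induce (s0 : Set V)).Connected) (hcard : 17 ≤ s0.card) :
    ∃ X : Finset V, X.card ≤ 8 ∧
      ∀ s : Finset V, s.card = s0.card → (T.induce (s : Set V)).Connected →
        (T.induce ((s0 ∩ s : Finset V) : Set V)).Connected →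
        s0.card - 3 ≤ (s0 ∩ s).card →
        ∀ (w : V) (hw : w ∈ s),
          IsCenter (T.induce (s : Set V)) ⟨w, Finset.mem_coe.mpr hw⟩ → w ∈ X := by
  classical
  set X : Finset V :=
    {w ∈ s0 | ∀ y ∈ s0, y ≠ w → s0.card ≤ 2 * (shadow T s0 w y).card + 6} with hXdef
  refine ⟨X, card_le_of_le_card_shadow hT hs0 (by omega) X (Finset.filter_subset _ _) ?_, ?_⟩
  · intro x hx y hy hxy
    rw [hXdef, Finset.mem_filter] at hx hy
    exact hx.2 y hy.1 hxy.symm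
  intro s hsc hs hinter hmove w hw hc
  have hw0 : w ∈ s0 := by
    by_contra hw0
    obtain ⟨y, hy⟩ : (s0 ∩ s).Nonempty := Finset.card_pos.1 (by omega)
    have hle := hc.two_mul_card_le hT hs hw (Finset.mem_inter.1 hy).2
      (fun h => hw0 (h ▸ (Finset.mem_inter.1 hy).1)) (A := s0 ∩ s) Finset.inter_subset_right ?_
    · omega
    intro z hz
    obtain ⟨p⟩ := hinter.preconnected ⟨y, Finset.mem_coe.2 hy⟩ ⟨z, Finset.mem_coe.2 hz⟩
    refine ⟨p.map (SimpleGraph.Embedding.induce _).toHom, fun hmem => hw0 ?_⟩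
    erw [SimpleGraph.Walk.support_map, List.mem_map] at hmem
    obtain ⟨c, -, rfl⟩ := hmem
    exact (Finset.mem_inter.1 (Finset.mem_coe.1 c.2)).1
  rw [hXdef, Finset.mem_filter]
  refine ⟨hw0, fun y hy hyw => ?_⟩
  set B : Finset V := {z ∈ s0 | z ∈ branchSet T w y} with hB
  have hsplit : B.card + (shadow T s0 w y).card = s0.card :=
    Finset.card_filter_add_card_filter_not _
  have hB1 : (B \ s).card ≤ 3 := by
    have h1 : (B \ s).card ≤ (s0 \ s).card :=
      Finset.card_le_card (Finset.sdiff_subset_sdiff (Finset.filter_subset _ _) subset_rfl)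
    have h2 := Finset.card_sdiff_add_card_inter s0 s
    omega
  have hB2 : 2 * (B ∩ s).card ≤ s.card := by
    rcases (B ∩ s).eq_empty_or_nonempty with he | ⟨z0, hz0⟩
    · simp [he]
    have hz0B : z0 ∈ branchSet T w y := (Finset.mem_filter.1 (Finset.mem_inter.1 hz0).1).2
    refine hc.two_mul_card_le hT hs hw (Finset.mem_inter.1 hz0).2 (ne_of_mem_branchSet hz0B)
      Finset.inter_subset_right fun z hz => ?_
    exact mem_branchSet_trans (mem_branchSet_comm.1 hz0B)
      (Finset.mem_filter.1 (Finset.mem_inter.1 hz).1).2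
  have hB3 := Finset.card_sdiff_add_card_inter B s
  omega
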